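/- Let n ≥ 1 and let B be a basis of the trivial unit interval positroid P_n with 1 ∉ B. Then B = {2,…,n} ∪ {j} for some j ∈ {n+1,…,2n}, and Ext(B) = {1} ∪ {n+1, n+2, …, j−1}. -/

import Mathlib

/-- Column `j` (1-indexed, `1 ≤ j ≤ 2n`) of the `n × 2n` matrix `M(n)`: the first `n`
columns form the identity matrix, and each of the last `n` columns has `i`-th entry
`(-1)^(n-i)` (1-indexed rows, realized here with 0-indexed `Fin n`). -/
def uipCol (n : ℕ) (j : ℕ) : Fin n → ℚ :=
  fun i => if j ≤ n then (if (i : ℕ) + 1 = j then 1 else 0)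
           else (-1 : ℚ) ^ (n - 1 - (i : ℕ))

/-- Independent sets of the trivial unit interval positroid `P_n`: subsets of the ground
set `{1, …, 2n}` indexing linearly independent columns of `M(n)`. -/
def uipIndep (n : ℕ) (S : Finset ℕ) : Prop :=
  S ⊆ Finset.Icc 1 (2 * n) ∧
    LinearIndependent ℚ (fun j : {x // x ∈ S} => uipCol n j.1)

/-- Bases of `P_n`: independent sets of size `n`. -/
def uipBasis (n : ℕ) (B : Finset ℕ) : Prop :=
  uipIndep n B ∧ B.card = n

/-- Circuits of `P_n`: minimal dependent subsets of the ground set. -/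
def uipCircuit (n : ℕ) (C : Finset ℕ) : Prop :=
  C ⊆ Finset.Icc 1 (2 * n) ∧ ¬ uipIndep n C ∧ ∀ D ⊂ C, uipIndep n D

/-- `e` is active with respect to `A` in `P_n`: there is a circuit `C` with
`e ∈ C ⊆ A ∪ {e}` and `e = min C`. -/
def uipActive (n : ℕ) (A : Finset ℕ) (e : ℕ) : Prop :=
  ∃ C : Finset ℕ, uipCircuit n C ∧ e ∈ C ∧ C ⊆ insert e A ∧ ∀ x ∈ C, e ≤ x

/-- The external set `Ext(A)`: active elements with respect to `A` not belonging to `A`. -/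
def uipExt (n : ℕ) (A : Finset ℕ) : Set ℕ :=
  {e | uipActive n A e ∧ e ∉ A}

/-- The external order on bases: `A ≤_Ext B` iff `A ⊆ B ∪ Ext(B)`. -/
def uipExtLe (n : ℕ) (A B : Finset ℕ) : Prop :=
  (A : Set ℕ) ⊆ (B : Set ℕ) ∪ uipExt n B

theorem sum_smul_uipCol_apply (n : ℕ) (S : Finset ℕ) (f : ℕ → ℚ) (r : Fin n) :
    (∑ x ∈ S, f x • uipCol n x) r =
      (if (r : ℕ) + 1 ∈ S then f (r + 1) else 0) +
        (∑ x ∈ S with n < x, f x) * (-1) ^ (n - 1 - (r : ℕ)) := by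
  have hr := r.isLt
  rw [Finset.sum_apply, Finset.sum_filter, Finset.sum_mul,
    ← Finset.sum_ite_eq S ((r : ℕ) + 1) f, ← Finset.sum_add_distrib]
  refine Finset.sum_congr rfl fun x _ => ?_
  by_cases hx : x ≤ n
  · simp [uipCol, hx, Nat.not_lt.2 hx]
  · have : (r : ℕ) + 1 ≠ x := by omega
    simp [uipCol, hx, this, Nat.lt_of_not_le hx]

theorem uipIndep_of_subsingleton (n : ℕ) (S : Finset ℕ) (hS : S ⊆ Finset.Icc 1 (2 * n))
    (huniq : ∀ x ∈ S, ∀ y ∈ S, n < x → n < y → x = y)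
    (h : (∀ x ∈ S, x ≤ n) ∨ ∃ i ∈ Finset.Icc 1 n, i ∉ S) : uipIndep n S := by
  refine ⟨hS, ?_⟩
  change LinearIndepOn ℚ (uipCol n) (S : Set ℕ)
  rw [linearIndepOn_finset_iff]
  intro f hf
  have key (r : Fin n) := (sum_smul_uipCol_apply n S f r).symm.trans (congrFun hf r)
  have hsum : ∑ x ∈ S with n < x, f x = 0 := by
    rcases h with h | ⟨i, hi, hiS⟩
    · rw [Finset.filter_false_of_mem fun x hx => Nat.not_lt.2 (h x hx), Finset.sum_empty]
    · rw [Finset.mem_Icc] at hi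
      have hk := key ⟨i - 1, by omega⟩
      simpa [Nat.sub_add_cancel hi.1, hiS] using hk
  intro x hx
  rcases le_or_gt x n with hxn | hxn
  · have hx1 := (Finset.mem_Icc.1 (hS hx)).1
    have hk := key ⟨x - 1, by omega⟩
    simpa [Nat.sub_add_cancel hx1, hx, hsum] using hk
  · rwa [Finset.sum_filter, Finset.sum_eq_single_of_mem x hx, if_pos hxn] at hsum
    intro y hy hyx
    exact if_neg fun hyn => hyx (huniq y hy x hx hyn hxn)

theorem uipIndep.eq_of_lt {n : ℕ} {S : Finset ℕ} (h : uipIndep n S) {x y : ℕ}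
    (hx : x ∈ S) (hy : y ∈ S) (hxn : n < x) (hyn : n < y) : x = y := by
  have heq : uipCol n x = uipCol n y := by
    funext r
    simp [uipCol, Nat.not_le.2 hxn, Nat.not_le.2 hyn]
  exact congrArg Subtype.val (h.2.injective (a₁ := ⟨x, hx⟩) (a₂ := ⟨y, hy⟩) heq)

theorem uipIndep.card_le {n : ℕ} {S : Finset ℕ} (h : uipIndep n S) : S.card ≤ n := by
  simpa using h.2.fintype_card_le_finrank

theorem uipCircuit_pair {n a b : ℕ} (hn : 1 ≤ n) (ha : n < a) (hab : a < b)
    (hb : b ≤ 2 * n) : uipCircuit n {a, b} := by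
  have hsub : ({a, b} : Finset ℕ) ⊆ Finset.Icc 1 (2 * n) := by
    intro x hx
    simp only [Finset.mem_insert, Finset.mem_singleton, Finset.mem_Icc] at hx ⊢
    omega
  refine ⟨hsub, fun h => hab.ne ?_, fun D hD => ?_⟩
  · exact h.eq_of_lt (by simp) (by simp) ha (ha.trans hab)
  · have hcard := Finset.card_lt_card hD
    rw [Finset.card_pair hab.ne] at hcard
    refine uipIndep_of_subsingleton n D (hD.1.trans hsub) (fun x hx y hy _ _ => ?_)
      (Or.inr ⟨1, by simpa using hn, fun h => ?_⟩)
    · exact Finset.card_le_one.1 (by omega) x hx y hy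
    · have := hD.1 h
      simp only [Finset.mem_insert, Finset.mem_singleton] at this
      omega

theorem uipCircuit_insert_Icc {n j : ℕ} (hj : n < j) (hj2 : j ≤ 2 * n) :
    uipCircuit n (insert j (Finset.Icc 1 n)) := by
  have hsub : insert j (Finset.Icc 1 n) ⊆ Finset.Icc 1 (2 * n) := by
    intro x hx
    simp only [Finset.mem_insert, Finset.mem_Icc] at hx ⊢
    omega
  refine ⟨hsub, fun h => ?_, fun D hD => ?_⟩
  · have hcard := h.card_le
    rw [Finset.card_insert_of_notMem (by simp [hj]), Nat.card_Icc] at hcard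
    omega
  · have hmem (x : ℕ) (hx : x ∈ D) : x = j ∨ 1 ≤ x ∧ x ≤ n := by
      simpa using hD.1 hx
    refine uipIndep_of_subsingleton n D (hD.1.trans hsub) (fun x hx y hy hxn hyn => ?_) ?_
    · have := hmem x hx
      have := hmem y hy
      omega
    · obtain ⟨i, hi, hiD⟩ := Finset.exists_of_ssubset hD
      rcases Finset.mem_insert.1 hi with rfl | hi
      · refine Or.inl fun x hx => ?_
        rcases hmem x hx with rfl | h
        · exact absurd hx hiD
        · exact h.2
      · exact Or.inr ⟨i, hi, hiD⟩

theorem uipBasis.exists_eq_insert {n : ℕ} (hn : 1 ≤ n) {B : Finset ℕ} (hB : uipBasis n B)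
    (h1 : 1 ∉ B) : ∃ j, n < j ∧ j ≤ 2 * n ∧ B = insert j (Finset.Icc 2 n) := by
  obtain ⟨hI, hcard⟩ := hB
  have hmem (x : ℕ) (hx : x ∈ B) : 2 ≤ x ∧ x ≤ 2 * n := by
    have := Finset.mem_Icc.1 (hI.1 hx)
    have : x ≠ 1 := fun h => h1 (h ▸ hx)
    omega
  obtain ⟨j, hjB, hj⟩ : ∃ j ∈ B, n < j := by
    by_contra! h
    have hle := Finset.card_le_card
      (fun x hx => Finset.mem_Icc.2 ⟨(hmem x hx).1, h x hx⟩ : B ⊆ Finset.Icc 2 n)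
    rw [Nat.card_Icc] at hle
    omega
  refine ⟨j, hj, (hmem j hjB).2, Finset.eq_of_subset_of_card_le (fun x hx => ?_) ?_⟩
  · rcases le_or_gt x n with hxn | hxn
    · exact Finset.mem_insert_of_mem (Finset.mem_Icc.2 ⟨(hmem x hx).1, hxn⟩)
    · exact Finset.mem_insert.2 (Or.inl (hI.eq_of_lt hx hjB hxn hj))
  · rw [Finset.card_insert_of_notMem (by simp [hj]), Nat.card_Icc]
    omega

theorem uipExt_insert_Icc {n j : ℕ} (hn : 1 ≤ n) (hj : n < j) (hj2 : j ≤ 2 * n) :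
    uipExt n (insert j (Finset.Icc 2 n)) = {1} ∪ Set.Icc (n + 1) (j - 1) := by
  ext e
  simp only [uipExt, Set.mem_ofPred_eq, Set.mem_union, Set.mem_singleton_iff, Set.mem_Icc]
  constructor
  · rintro ⟨⟨C, hC, heC, hCB, hmin⟩, heB⟩
    have he := Finset.mem_Icc.1 (hC.1 heC)
    simp only [Finset.mem_insert, Finset.mem_Icc] at heB
    by_contra hne
    have hC1 (x : ℕ) (hx : x ∈ C) : x = e := by
      have h1 := hmin x hx
      have h2 := hCB hx
      simp only [Finset.mem_insert, Finset.mem_Icc] at h2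
      omega
    refine hC.2.1 (uipIndep_of_subsingleton n C hC.1 (fun x hx y hy _ _ => ?_)
      (Or.inr ⟨1, by simpa using hn, fun h => ?_⟩))
    · rw [hC1 x hx, hC1 y hy]
    · have := hC1 1 h
      omega
  · rintro (rfl | he)
    · refine ⟨⟨_, uipCircuit_insert_Icc hj hj2, by simp [hn], fun x hx => ?_, fun x hx => ?_⟩, ?_⟩
      all_goals simp only [Finset.mem_insert, Finset.mem_Icc] at *; omega
    · refine ⟨⟨_, uipCircuit_pair hn (by omega : n < e) (by omega : e < j) hj2, by simp,
        fun x hx => ?_, fun x hx => ?_⟩, ?_⟩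
      all_goals simp only [Finset.mem_insert, Finset.mem_singleton, Finset.mem_Icc] at *; omega

/-- A basis B of P_n with 1 ∉ B equals {2,…,n} ∪ {j} for some j ∈ {n+1,…,2n}, and
Ext(B) = {1} ∪ {n+1, …, j-1}. -/
theorem uip_ext_of_one_not_mem (n : ℕ) (hn : 1 ≤ n) (B : Finset ℕ) (hB : uipBasis n B)
    (h1 : 1 ∉ B) :
    ∃ j, n + 1 ≤ j ∧ j ≤ 2 * n ∧ B = insert j (Finset.Icc 2 n) ∧
      uipExt n B = {1} ∪ Set.Icc (n + 1) (j - 1) := by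
  obtain ⟨j, hj, hj2, rfl⟩ := hB.exists_eq_insert hn h1
  exact ⟨j, hj, hj2, rfl, uipExt_insert_Icc hn hj hj2⟩
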